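/- arXiv:1508.07209 — 2 statements merged into one kernel-verified Lean document; each statement's English description precedes it below -/
import Mathlib

section
/- Let p ∈ M_n(ℂ) be a rank-1 orthogonal projection. Then the set {−i[A, p] : A ∈ M_n(ℂ), A self-adjoint} coincides with the set of all self-adjoint matrices v ∈ M_n(ℂ) satisfying p v p = 0 and v = p v + v p. Moreover, for self-adjoint A₁, A₂, one has −i[A₁, p] = −i[A₂, p] if and only if [A₁ − A₂, p] = 0. -/
open Matrix

/-- For a rank-1 orthogonal projection `p`, the tangent vectors `-i[A, p]` (with `A`
self-adjoint) are exactly the self-adjoint matrices `v` with `p v p = 0` and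
`v = p v + v p`; moreover two self-adjoint matrices `A₁, A₂` give the same tangent
vector iff `[A₁ - A₂, p] = 0`. -/
theorem stmt1 {n : ℕ} (p : Matrix (Fin n) (Fin n) ℂ)
    (hp2 : p * p = p) (hpa : pᴴ = p) (hptr : p.trace = 1) :
    ({v | ∃ A : Matrix (Fin n) (Fin n) ℂ, Aᴴ = A ∧
        v = (-Complex.I) • (A * p - p * A)} =
      {v : Matrix (Fin n) (Fin n) ℂ | vᴴ = v ∧ p * v * p = 0 ∧ v = p * v + v * p}) ∧
    ∀ A₁ A₂ : Matrix (Fin n) (Fin n) ℂ, A₁ᴴ = A₁ → A₂ᴴ = A₂ →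
      ((-Complex.I) • (A₁ * p - p * A₁) = (-Complex.I) • (A₂ * p - p * A₂) ↔
        (A₁ - A₂) * p - p * (A₁ - A₂) = 0) := by
  have hI : (-Complex.I) ≠ 0 := neg_ne_zero.mpr Complex.I_ne_zero
  refine ⟨?_, ?_⟩
  · ext v
    simp only [Set.mem_setOf_eq]
    constructor
    · rintro ⟨A, hA, rfl⟩
      have h1 : p * (A * p - p * A) * p = 0 := by
        have : p * (A * p - p * A) * p = p * A * (p * p) - (p * p) * A * p := by noncomm_ring
        rw [this, hp2, sub_self]
      have h2 : A * p - p * A = p * (A * p - p * A) + (A * p - p * A) * p := by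
        have : p * (A * p - p * A) + (A * p - p * A) * p = A * (p * p) - (p * p) * A := by
          noncomm_ring
        rw [this, hp2]
      refine ⟨?_, ?_, ?_⟩
      · rw [conjTranspose_smul, conjTranspose_sub, conjTranspose_mul, conjTranspose_mul, hA, hpa,
          ← neg_sub (A * p) (p * A), smul_neg, ← neg_smul]
        simp
      · rw [mul_smul_comm, smul_mul_assoc, h1, smul_zero]
      · rw [mul_smul_comm, smul_mul_assoc, ← smul_add, ← h2]
    · rintro ⟨hv, h0, h1⟩
      refine ⟨Complex.I • (v * p - p * v), ?_, ?_⟩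
      · rw [conjTranspose_smul, conjTranspose_sub, conjTranspose_mul, conjTranspose_mul, hv, hpa,
          ← neg_sub (v * p) (p * v), smul_neg, ← neg_smul]
        simp
      · rw [mul_smul_comm, smul_mul_assoc, ← smul_sub, smul_smul]
        have : (v * p - p * v) * p - p * (v * p - p * v)
            = v * (p * p) + (p * p) * v - (p * v * p + p * v * p) := by noncomm_ring
        rw [this, hp2, h0, add_zero, sub_zero, add_comm (v * p), ← h1]
        simp
  · intro A₁ A₂ _ _
    rw [(smul_right_injective _ hI).eq_iff, ← sub_eq_zero]
    have : A₁ * p - p * A₁ - (A₂ * p - p * A₂) = (A₁ - A₂) * p - p * (A₁ - A₂) := by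
      noncomm_ring
    rw [this]
end

section
/- Let n ≥ 1 and let p ∈ M_n(ℂ) be a rank-1 orthogonal projection. Then the real vector space {−i[A, p] : A ∈ M_n(ℂ), A self-adjoint} has real dimension 2n − 2 (the real dimension of the projective space P(ℂⁿ)). -/
open Matrix

theorem aux_uc {n : ℕ} (p : Matrix (Fin n) (Fin n) ℂ)
    (h1 : Module.finrank ℂ (LinearMap.range (Matrix.toLin' p)) = 1) (hp2 : p * p = p) :
    ∃ u c : Fin n → ℂ, p = vecMulVec u c ∧ c ⬝ᵥ u = 1 := by
  obtain ⟨⟨v, hv⟩, hv0, h⟩ := finrank_eq_one_iff'.1 h1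
  have hv0' : v ≠ 0 := fun h0 => hv0 (by simp [h0])
  have hc : ∀ x : Fin n → ℂ, ∃ c : ℂ, p *ᵥ x = c • v := by
    intro x
    obtain ⟨c, hc⟩ := h ⟨p *ᵥ x, ⟨x, by simp⟩⟩
    exact ⟨c, by simpa using (congrArg Subtype.val hc).symm⟩
  choose c hc using hc
  have hp : p = vecMulVec v (fun j => c (Pi.single j 1)) := by
    ext i j
    have := congrFun (hc (Pi.single j 1)) i
    simp [vecMulVec_apply] at this ⊢
    rw [this, mul_comm]
  refine ⟨v, _, hp, ?_⟩
  obtain ⟨x, hx⟩ := hv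
  have hpv : p *ᵥ v = v := by
    rw [← hx]; simp [hp2]
  rw [hp, vecMulVec_mulVec] at hpv
  obtain ⟨i, hi⟩ := Function.ne_iff.1 hv0'
  have := congrFun hpv i
  simp at this hi
  exact mul_left_cancel₀ hi (this.trans (mul_one _).symm)

theorem stmt2 {n : ℕ} (hn : 1 ≤ n) (p : Matrix (Fin n) (Fin n) ℂ)
    (hp2 : p * p = p) (hpa : pᴴ = p) (hptr : p.trace = 1) :
    Module.finrank ℝ
      (Submodule.span ℝ {v : Matrix (Fin n) (Fin n) ℂ |
        ∃ A : Matrix (Fin n) (Fin n) ℂ, Aᴴ = A ∧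
          v = (-Complex.I) • (A * p - p * A)}) = 2 * n - 2 := by
  have h1 : Module.finrank ℂ (LinearMap.range (Matrix.toLin' p)) = 1 := by
    have hid : IsIdempotentElem (Matrix.toLin' p) := by
      unfold IsIdempotentElem
      rw [Module.End.mul_eq_comp, ← Matrix.toLin'_mul, hp2]
    have := (LinearMap.IsIdempotentElem.isProj_range _ hid).trace
    rw [Matrix.trace_toLin'_eq, hptr] at this
    exact_mod_cast this.symm
  have hK : Module.finrank ℂ (LinearMap.ker (Matrix.toLin' p)) = n - 1 := by
    have := (Matrix.toLin' p).finrank_range_add_finrank_ker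
    simp only [Module.finrank_fin_fun] at this
    omega
  obtain ⟨u, c, hp, hcu⟩ := aux_uc p h1 hp2
  let f : (Fin n → ℂ) →ₗ[ℝ] Matrix (Fin n) (Fin n) ℂ :=
    { toFun := fun w => vecMulVec w c + (vecMulVec w c)ᴴ
      map_add' := by
        intro x y
        rw [add_vecMulVec, conjTranspose_add]; abel
      map_smul' := by
        intro r x
        rw [smul_vecMulVec, conjTranspose_smul]; simp }
  have hf : ∀ w, f w = vecMulVec w c + (vecMulVec w c)ᴴ := fun _ => rfl
  have hfM : ∀ M : Matrix (Fin n) (Fin n) ℂ, f (M *ᵥ u) = M * p + (M * p)ᴴ := by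
    intro M
    rw [hf, hp, mul_vecMulVec]
  have hMp : ∀ w : Fin n → ℂ, vecMulVec w c * p = vecMulVec w c := by
    intro w
    rw [hp, vecMulVec_mul_vecMulVec, hcu]; simp
  have hpM : ∀ w : Fin n → ℂ, p *ᵥ w = 0 → p * vecMulVec w c = 0 := by
    intro w hw
    rw [mul_vecMulVec, hw]; simp
  have hMhp : ∀ w : Fin n → ℂ, p *ᵥ w = 0 → (vecMulVec w c)ᴴ * p = 0 := by
    intro w hw
    have := congrArg conjTranspose (hpM w hw)
    rwa [conjTranspose_mul, hpa, conjTranspose_zero] at this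
  have hpMh : ∀ w : Fin n → ℂ, p * (vecMulVec w c)ᴴ = (vecMulVec w c)ᴴ := by
    intro w
    have := congrArg conjTranspose (hMp w)
    rwa [conjTranspose_mul, hpa] at this
  let K := (LinearMap.ker (Matrix.toLin' p)).restrictScalars ℝ
  have hinj : Function.Injective (f.domRestrict K) := by
    rw [← LinearMap.ker_eq_bot, LinearMap.ker_eq_bot']
    rintro ⟨w, hw⟩ h
    have hw' : p *ᵥ w = 0 := by simpa [K] using hw
    have h' : f w = 0 := h
    have h2 : f w * p = 0 := by rw [h']; simp
    rw [hf, add_mul, hMp, hMhp w hw', add_zero] at h2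
    have h3 : vecMulVec w c *ᵥ u = 0 := by rw [h2]; simp
    rw [vecMulVec_mulVec, hcu] at h3
    ext1
    simpa using h3
  have hspan : Submodule.span ℝ {v : Matrix (Fin n) (Fin n) ℂ |
        ∃ A : Matrix (Fin n) (Fin n) ℂ, Aᴴ = A ∧
          v = (-Complex.I) • (A * p - p * A)} = LinearMap.range (f.domRestrict K) := by
    apply le_antisymm
    · rw [Submodule.span_le]
      rintro v ⟨A, hA, rfl⟩
      let M : Matrix (Fin n) (Fin n) ℂ := (-Complex.I) • A
      refine ⟨⟨(M - p * M) *ᵥ u, ?_⟩, ?_⟩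
      · simp [K, mulVec_mulVec, mul_sub, ← mul_assoc, hp2]
      · change f ((M - p * M) *ᵥ u) = _
        rw [hfM]
        simp only [M, sub_mul, conjTranspose_sub, conjTranspose_mul, conjTranspose_smul, hA, hpa,
          mul_sub, smul_mul_assoc, mul_smul_comm, smul_sub, mul_assoc]
        simp
    · rintro _ ⟨⟨w, hw⟩, rfl⟩
      have hw' : p *ᵥ w = 0 := by simpa [K] using hw
      apply Submodule.subset_span
      refine ⟨Complex.I • (vecMulVec w c - (vecMulVec w c)ᴴ), ?_, ?_⟩
      · rw [conjTranspose_smul, conjTranspose_sub, conjTranspose_conjTranspose]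
        simp
        rw [← smul_neg, neg_sub]
      · change f w = _
        rw [hf, smul_mul_assoc, mul_smul_comm, sub_mul, mul_sub, hMp, hpM w hw', hMhp w hw', hpMh,
          ← smul_sub, smul_smul]
        simp
  rw [hspan, LinearMap.finrank_range_of_inj hinj]
  have : Module.finrank ℝ K = 2 * Module.finrank ℂ (LinearMap.ker (Matrix.toLin' p)) :=
    finrank_real_of_complex _
  rw [this, hK]
  omega
end
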